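/- On a slice the series sums in closed form: if I ∈ 𝕊 and q = x + y • I with x, y ∈ ℝ (so q lies in the slice ℂ_I), then ∑'ₘ (m!)⁻¹ • ((conj q)ᵐ * I * qᵐ) = exp(‖q‖²) • I; equivalently 𝔠_I(q) := exp(−‖q‖²) • ∑'ₘ (m!)⁻¹ • ((conj q)ᵐ * I * qᵐ) equals I. -/

import Mathlib

open scoped Quaternion

/-- If `a` commutes with `q`, then `conj(q)ᵐ * a * qᵐ = ‖q‖²ᵐ • a`. -/
theorem Quaternion.star_pow_mul_mul_pow {q a : ℍ[ℝ]} (h : Commute q a) (m : ℕ) :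
    star q ^ m * a * q ^ m = ((‖q‖ ^ 2) ^ m) • a := by
  have hstar : Commute (star q) q := star_comm_self
  rw [mul_assoc, ← (h.pow_left m).eq, ← mul_assoc, ← hstar.mul_pow, Quaternion.star_mul_self,
    Quaternion.normSq_eq_norm_mul_self, ← pow_two, ← Quaternion.coe_pow,
    Quaternion.coe_mul_eq_smul]

/-- If `a` commutes with `q`, then `∑ₘ (m!)⁻¹ • (conj(q)ᵐ * a * qᵐ) = exp(‖q‖²) • a`. -/
theorem Quaternion.hasSum_star_pow_mul_mul_pow {q a : ℍ[ℝ]} (h : Commute q a) :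
    HasSum (fun m : ℕ => ((m.factorial : ℝ)⁻¹) • (star q ^ m * a * q ^ m))
      (Real.exp (‖q‖ ^ 2) • a) := by
  have hexp : HasSum (fun m : ℕ => ((m.factorial : ℝ)⁻¹) • (‖q‖ ^ 2) ^ m)
      (Real.exp (‖q‖ ^ 2)) := by
    rw [Real.exp_eq_exp_ℝ]
    exact NormedSpace.exp_series_hasSum_exp' (𝕂 := ℝ) _
  simpa only [Quaternion.star_pow_mul_mul_pow h, smul_assoc] using hexp.smul_const a

/-- On a slice the series sums in closed form: if `I ∈ 𝕊` and `q = x + y • I`,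
then `∑'ₘ (m!)⁻¹ • ((conj q)ᵐ * I * qᵐ) = exp (‖q‖²) • I`; equivalently
`𝔠_I(q) = I`. -/
theorem quaternion_cI_on_slice
    (I : ℍ[ℝ]) (hIre : I.re = 0) (hInorm : ‖I‖ = 1)
    (q : ℍ[ℝ]) (x y : ℝ) (hq : q = (x : ℍ[ℝ]) + y • I) :
    (∑' m : ℕ, ((m.factorial : ℝ)⁻¹) • ((star q) ^ m * I * q ^ m)) =
      Real.exp (‖q‖ ^ 2) • I ∧
    Real.exp (-‖q‖ ^ 2) •
        ∑' m : ℕ, ((m.factorial : ℝ)⁻¹) • ((star q) ^ m * I * q ^ m) = I := by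
  have hcomm : Commute q I := by
    rw [hq]
    exact (Quaternion.coe_commute x I).add_left ((Commute.refl I).smul_left y)
  rw [(Quaternion.hasSum_star_pow_mul_mul_pow hcomm).tsum_eq]
  refine ⟨rfl, ?_⟩
  rw [smul_smul, ← Real.exp_add, neg_add_cancel, Real.exp_zero, one_smul]
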